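/- The number of maximal flags in F^n whose label is the decreasing permutation (σ(j) = n+1−j for all j) equals q^{n(n−1)/2}, where q is the cardinality of F. -/

import Mathlib

open Matrix

variable {n : ℕ} {F : Type} [Field F]

/-- `(r, j)` is a pivot position of `M`: the entry `M r j` is nonzero and all entries of
column `j` strictly below row `r` vanish (i.e. `r` is the largest row index with `M r j ≠ 0`). -/
def IsPivot (M : Matrix (Fin n) (Fin n) F) (r j : Fin n) : Prop :=
  M r j ≠ 0 ∧ ∀ r' : Fin n, r < r' → M r' j = 0

/-- The span of the first `j` columns of `M` (columns with index `< j` in 0-based indexing). -/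
def colSpan (M : Matrix (Fin n) (Fin n) F) (j : ℕ) : Submodule F (Fin n → F) :=
  Submodule.span F ((fun i : Fin n => Mᵀ i) '' {i : Fin n | (i : ℕ) < j})

/-- A flag: a nonempty finite set of proper nonzero subspaces of `F^n` forming a chain. -/
def IsFlag (g : Set (Submodule F (Fin n → F))) : Prop :=
  g.Finite ∧ g.Nonempty ∧ IsChain (· ≤ ·) g ∧ ∀ V ∈ g, V ≠ ⊥ ∧ V ≠ ⊤

/-- A maximal flag: a flag containing a subspace of every dimension `1,…,n-1`. -/
def IsMaximalFlag (f : Set (Submodule F (Fin n → F))) : Prop :=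
  IsFlag f ∧ ∀ j : ℕ, 1 ≤ j → j ≤ n - 1 → ∃ V ∈ f, Module.finrank F V = j

/-- Conditions (i)–(iii) for a matrix representation of a flag `f`:
(i) for every `V ∈ f` the first `dim V` columns of `M` span `V`, and all `n` columns span `F^n`;
(ii) every pivot entry equals `1`;
(iii) entries in the same row as a pivot and strictly to its right vanish. -/
def IsRep (f : Set (Submodule F (Fin n → F))) (M : Matrix (Fin n) (Fin n) F) : Prop :=
  (∀ V ∈ f, colSpan M (Module.finrank F V) = V) ∧
  colSpan M n = ⊤ ∧
  (∀ r j : Fin n, IsPivot M r j → M r j = 1) ∧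
  (∀ r j j' : Fin n, IsPivot M r j → j < j' → M r j' = 0)

/-- Columns `i` and `i'` lie in the same block of the block decomposition induced by the
flag `g` (blocks are the intervals of columns between consecutive dimensions of members of `g`). -/
def SameBlock (g : Set (Submodule F (Fin n → F))) (i i' : Fin n) : Prop :=
  ∀ V ∈ g, ((i : ℕ) < Module.finrank F V ↔ (i' : ℕ) < Module.finrank F V)

/-- The minimal matrix representation of a flag `g`: conditions (i)–(iii) together with
(iv) within each block, entries in the same row as a pivot of the block and strictly to its left
within the block vanish; (v) within each block, pivot row indices strictly increase. -/
def IsMinRep (g : Set (Submodule F (Fin n → F))) (M : Matrix (Fin n) (Fin n) F) : Prop :=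
  IsRep g M ∧
  (∀ r i i' : Fin n, SameBlock g i i' → IsPivot M r i → i' < i → M r i' = 0) ∧
  (∀ r r' i i' : Fin n, SameBlock g i i' → IsPivot M r i → IsPivot M r' i' → i < i' → r < r')

/-- `σ` is the label of the maximal flag `f`: `σ j` is the pivot row of the `j`-th column of
the minimal matrix representation of `f`. -/
def IsLabel (f : Set (Submodule F (Fin n → F))) (σ : Equiv.Perm (Fin n)) : Prop :=
  ∃ M : Matrix (Fin n) (Fin n) F, IsRep f M ∧ ∀ j : Fin n, IsPivot M (σ j) j

/-- Strict lexicographic order on permutations in one-line notation `(σ 0, …, σ (n-1))`. -/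
def LexLt {n : ℕ} (σ τ : Equiv.Perm (Fin n)) : Prop :=
  ∃ j : Fin n, (∀ i : Fin n, i < j → σ i = τ i) ∧ σ j < τ j

/-- `σ` is the lexicographically least label among the labels of maximal flags containing `g`. -/
def IsMinlabel (g : Set (Submodule F (Fin n → F))) (σ : Equiv.Perm (Fin n)) : Prop :=
  (∃ f, IsMaximalFlag f ∧ g ⊆ f ∧ IsLabel f σ) ∧
  ∀ (f : Set (Submodule F (Fin n → F))) (τ : Equiv.Perm (Fin n)),
    IsMaximalFlag f → g ⊆ f → IsLabel f τ → σ = τ ∨ LexLt σ τ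

/-- `t` is a (0-based) ascent of `σ`: `σ t < σ (t+1)`.  (In the 1-based indexing of the paper
this corresponds to the ascent `(σ(t+1), σ(t+2))` at position `t+1`.) -/
def Ascent {n : ℕ} (σ : Equiv.Perm (Fin n)) (t : ℕ) : Prop :=
  ∃ h : t + 1 < n, σ ⟨t, Nat.lt_of_succ_lt h⟩ < σ ⟨t + 1, h⟩

/-- `σ` is the decreasing permutation `σ(j) = n + 1 - j` (in 0-based indexing, `n - 1 - j`). -/
def IsDecreasing {n : ℕ} (σ : Equiv.Perm (Fin n)) : Prop :=
  ∀ j : Fin n, (σ j : ℕ) = n - 1 - (j : ℕ)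

/-- `M` has ones on the antidiagonal and zeros below it. -/
def IsAntiUnitriangular (M : Matrix (Fin n) (Fin n) F) : Prop :=
  (∀ j : Fin n, M j.rev j = 1) ∧ ∀ r j : Fin n, j.rev < r → M r j = 0

/-- The set of spans of the first `k` columns of `M`, for `1 ≤ k < n`. -/
def flagOf (M : Matrix (Fin n) (Fin n) F) : Set (Submodule F (Fin n → F)) :=
  colSpan M '' Set.Ico 1 n

/-- The matrix with ones on the antidiagonal, zeros below it, and prescribed entries above it. -/
def antiUnitriangular (x : (Σ i : Fin n, Fin i) → F) : Matrix (Fin n) (Fin n) F :=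
  fun r j => if h : r < j.rev then x ⟨j.rev, ⟨r, h⟩⟩ else if r = j.rev then 1 else 0

theorem colSpan_mono (M : Matrix (Fin n) (Fin n) F) : Monotone (colSpan M) := fun _ _ h =>
  Submodule.span_mono (Set.image_mono fun _ hi => lt_of_lt_of_le hi h)

theorem colSpan_succ (M : Matrix (Fin n) (Fin n) F) {k : ℕ} (hk : k < n) :
    colSpan M (k + 1) = Submodule.span F (insert (Mᵀ ⟨k, hk⟩)
      ((fun i : Fin n => Mᵀ i) '' {i : Fin n | (i : ℕ) < k})) := by
  have hset : {i : Fin n | (i : ℕ) < k + 1} = insert ⟨k, hk⟩ {i : Fin n | (i : ℕ) < k} := by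
    ext i
    simp only [Set.mem_ofPred_eq, Set.mem_insert_iff, Fin.ext_iff]
    omega
  rw [colSpan, hset, Set.image_insert_eq]

theorem IsPivot.row_unique {M : Matrix (Fin n) (Fin n) F} {r s j : Fin n}
    (hr : IsPivot M r j) (hs : IsPivot M s j) : r = s := by
  rcases lt_trichotomy r s with h | h | h
  · exact absurd (hr.2 s h) hs.1
  · exact h
  · exact absurd (hs.2 r h) hr.1

theorem IsDecreasing.apply_eq_rev {σ : Equiv.Perm (Fin n)} (hσ : IsDecreasing σ) (j : Fin n) :
    σ j = j.rev := by
  ext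
  rw [hσ j, Fin.val_rev]
  omega

theorem isAntiUnitriangular_antiUnitriangular (x : (Σ i : Fin n, Fin i) → F) :
    IsAntiUnitriangular (antiUnitriangular x) := by
  refine ⟨fun j => by simp [antiUnitriangular], fun r j h => ?_⟩
  simp [antiUnitriangular, h.not_gt, h.ne']

theorem antiUnitriangular_injective :
    Function.Injective (antiUnitriangular : ((Σ i : Fin n, Fin i) → F) → _) := by
  rintro x y h
  funext ⟨i, r⟩
  obtain ⟨j, rfl⟩ := Fin.rev_surjective i
  have hr : (⟨r, r.2.trans j.rev.2⟩ : Fin n) < j.rev := r.2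
  simpa [antiUnitriangular, hr] using congr_fun₂ h ⟨r, r.2.trans j.rev.2⟩ j

namespace IsAntiUnitriangular

variable {M N : Matrix (Fin n) (Fin n) F}

theorem exists_eq (hM : IsAntiUnitriangular M) : ∃ x, antiUnitriangular x = M := by
  refine ⟨fun p => M ⟨p.2, p.2.2.trans p.1.2⟩ p.1.rev, ?_⟩
  ext r j
  rcases lt_trichotomy r j.rev with h | rfl | h
  · simp [antiUnitriangular, h]
  · simp [antiUnitriangular, hM.1]
  · simp [antiUnitriangular, h.not_gt, h.ne', hM.2 r j h]

theorem isPivot (hM : IsAntiUnitriangular M) (j : Fin n) : IsPivot M j.rev j :=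
  ⟨by simp [hM.1 j], fun r h => hM.2 r j h⟩

theorem linearIndependent_col (hM : IsAntiUnitriangular M) : LinearIndependent F M.col := by
  have htri : (M.submatrix Fin.rev id).IsLowerTriangular := fun i j (hij : i < j) =>
    hM.2 _ _ (Fin.rev_lt_rev.2 hij)
  have hdet : (M.submatrix Fin.rev id).det ≠ 0 := by
    rw [Matrix.det_of_isLowerTriangular _ htri]
    simp [hM.1]
  exact LinearIndependent.of_comp (LinearMap.funLeft F F Fin.rev)
    (Matrix.linearIndependent_cols_of_det_ne_zero hdet)

theorem finrank_colSpan (hM : IsAntiUnitriangular M) {k : ℕ} (hk : k ≤ n) :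
    Module.finrank F (colSpan M k) = k := by
  rw [colSpan, Set.image_eq_range]
  refine (finrank_span_eq_card (hM.linearIndependent_col.comp _ Subtype.val_injective)).trans ?_
  rw [← Nat.card_eq_fintype_card]
  exact (Nat.card_congr (Fin.castLEquiv hk).symm).trans (Nat.card_fin k)

theorem colSpan_eq_top (hM : IsAntiUnitriangular M) : colSpan M n = ⊤ :=
  Submodule.eq_top_of_finrank_eq (by simp [hM.finrank_colSpan le_rfl])

theorem eq_zero_of_mem_colSpan (hM : IsAntiUnitriangular M) {k : ℕ} (hk : k ≤ n) {v : Fin n → F}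
    (hv : v ∈ colSpan M k) (h0 : ∀ r : Fin n, n ≤ r + k → v r = 0) : v = 0 := by
  induction k generalizing v with
  | zero => simpa [colSpan] using hv
  | succ k ih =>
    rw [colSpan_succ M hk, Submodule.mem_span_insert] at hv
    obtain ⟨a, w, hw, rfl⟩ := hv
    have hw0 : w = 0 := by
      refine ih (by omega) hw fun r hr => ?_
      have h1 := h0 r (by omega)
      have h2 : M r ⟨k, hk⟩ = 0 := hM.2 _ _ (by rw [Fin.lt_def, Fin.val_rev]; simp only; omega)
      simpa [h2] using h1
    have h1 := h0 (Fin.rev ⟨k, hk⟩) (by rw [Fin.val_rev]; simp only; omega)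
    have ha : a = 0 := by simpa [hw0, hM.1] using h1
    simp [ha, hw0]

theorem colSpan_congr (hM : IsAntiUnitriangular M) (hN : IsAntiUnitriangular N)
    (h : flagOf M = flagOf N) {k : ℕ} (hk : k ≤ n) : colSpan M k = colSpan N k := by
  rcases Nat.eq_zero_or_pos k with rfl | hk0
  · simp [colSpan]
  rcases hk.eq_or_lt with rfl | hkn
  · rw [hM.colSpan_eq_top, hN.colSpan_eq_top]
  obtain ⟨l, hl, hlk⟩ : colSpan M k ∈ flagOf N := h ▸ Set.mem_image_of_mem _ ⟨hk0, hkn⟩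
  have := hN.finrank_colSpan hl.2.le
  rw [hlk, hM.finrank_colSpan hk] at this
  rw [← hlk, this]

theorem eq_of_flagOf_eq (hM : IsAntiUnitriangular M) (hN : IsAntiUnitriangular N)
    (h : flagOf M = flagOf N) : M = N := by
  have col_mem (A : Matrix (Fin n) (Fin n) F) (j : Fin n) : Aᵀ j ∈ colSpan A (j + 1) :=
    Submodule.subset_span ⟨j, Nat.lt_succ_self _, rfl⟩
  ext r j
  have hj := hM.colSpan_congr hN h (k := j + 1) j.2
  have hsub : Mᵀ j - Nᵀ j = 0 := by
    refine hM.eq_zero_of_mem_colSpan (k := j + 1) j.2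
      (Submodule.sub_mem _ (col_mem M j) (hj ▸ col_mem N j)) fun s hs => ?_
    have hle : j.rev ≤ s := by rw [Fin.le_def, Fin.val_rev]; omega
    rcases hle.eq_or_lt with rfl | hlt
    · simp [hM.1, hN.1]
    · simp [hM.2 _ _ hlt, hN.2 _ _ hlt]
  exact sub_eq_zero.1 (congr_fun hsub r)

theorem isMaximalFlag_flagOf (hM : IsAntiUnitriangular M) (hn : 2 ≤ n) :
    IsMaximalFlag (flagOf M) := by
  refine ⟨⟨(Set.finite_Ico 1 n).image _, ⟨_, 1, ⟨le_rfl, hn⟩, rfl⟩, ?_, ?_⟩, fun k hk hkn =>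
    ⟨_, ⟨k, ⟨hk, by omega⟩, rfl⟩, hM.finrank_colSpan (by omega)⟩⟩
  · rintro _ ⟨k, -, rfl⟩ _ ⟨l, -, rfl⟩ -
    exact (le_total k l).imp (fun h => colSpan_mono M h) (fun h => colSpan_mono M h)
  · rintro _ ⟨k, ⟨hk, hkn⟩, rfl⟩
    have hf := hM.finrank_colSpan hkn.le
    constructor <;> intro h <;> rw [h] at hf <;> simp at hf <;> omega

theorem isRep_flagOf (hM : IsAntiUnitriangular M) : IsRep (flagOf M) M := by
  refine ⟨?_, hM.colSpan_eq_top, fun r j h => ?_, fun r j j' h hj => ?_⟩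
  · rintro _ ⟨k, hk, rfl⟩
    rw [hM.finrank_colSpan hk.2.le]
  · rw [h.row_unique (hM.isPivot j), hM.1]
  · rw [h.row_unique (hM.isPivot j)]
    exact hM.2 _ _ (Fin.rev_lt_rev.2 hj)

end IsAntiUnitriangular

theorem IsRep.eq_flagOf {f : Set (Submodule F (Fin n → F))} {M : Matrix (Fin n) (Fin n) F}
    (hM : IsRep f M) (hf : IsMaximalFlag f) : f = flagOf M := by
  ext V
  constructor
  · intro hV
    obtain ⟨hbot, htop⟩ := hf.1.2.2.2 V hV
    refine ⟨Module.finrank F V, ⟨?_, ?_⟩, hM.1 V hV⟩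
    · exact Submodule.one_le_finrank_iff.2 hbot
    · simpa using Submodule.finrank_lt htop
  · rintro ⟨k, ⟨hk, hkn⟩, rfl⟩
    obtain ⟨V, hV, rfl⟩ := hf.2 k hk (by omega)
    rwa [hM.1 V hV]

theorem setOf_isMaximalFlag_isLabel_eq_range (hn : 2 ≤ n) {σ : Equiv.Perm (Fin n)}
    (hσ : IsDecreasing σ) :
    {f : Set (Submodule F (Fin n → F)) | IsMaximalFlag f ∧ IsLabel f σ} =
      Set.range fun x : (Σ i : Fin n, Fin i) → F => flagOf (antiUnitriangular x) := by
  ext f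
  constructor
  · rintro ⟨hf, M, hM, hpiv⟩
    simp only [hσ.apply_eq_rev] at hpiv
    have hanti : IsAntiUnitriangular M :=
      ⟨fun j => hM.2.2.1 _ _ (hpiv j), fun r j h => (hpiv j).2 r h⟩
    obtain ⟨x, rfl⟩ := hanti.exists_eq
    exact ⟨x, (hM.eq_flagOf hf).symm⟩
  · rintro ⟨x, rfl⟩
    have hM := isAntiUnitriangular_antiUnitriangular x
    refine ⟨hM.isMaximalFlag_flagOf hn, _, hM.isRep_flagOf, fun j => ?_⟩
    rw [hσ.apply_eq_rev]
    exact hM.isPivot j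

/-- the number of maximal flags whose label is the decreasing permutation
equals `q^{n(n-1)/2}`. -/
theorem card_maximal_flags_with_maximal_label
    [Fintype F] (hn : 2 ≤ n) (σ : Equiv.Perm (Fin n)) (hσ : IsDecreasing σ) :
    {f : Set (Submodule F (Fin n → F)) | IsMaximalFlag f ∧ IsLabel f σ}.ncard =
      Fintype.card F ^ (n * (n - 1) / 2) := by
  have hinj : Function.Injective
      fun x : (Σ i : Fin n, Fin i) → F => flagOf (antiUnitriangular x) := fun x y h =>
    antiUnitriangular_injective ((isAntiUnitriangular_antiUnitriangular x).eq_of_flagOf_eq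
      (isAntiUnitriangular_antiUnitriangular y) h)
  rw [setOf_isMaximalFlag_isLabel_eq_range hn hσ, ← Nat.card_coe_set_eq,
    Nat.card_range_of_injective hinj, Nat.card_eq_fintype_card, Fintype.card_fun,
    Fintype.card_sigma]
  simp only [Fintype.card_fin]
  rw [Fin.sum_univ_eq_sum_range (fun i => i) n, Finset.sum_range_id]
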